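/- arXiv:2408.12901 — 3 statements merged into one kernel-verified Lean document; each statement's English description precedes it below -/
import Mathlib

section
/- Let G be a finite abelian group with the uniformly periodic tiling (UPT) property, and let m be a square-free positive integer with gcd(|G|, m) = 1. Then the direct product group G × Z_m has the periodic tiling (PT) property. -/
/-- `(Ω, T)` is a tiling pair of the abelian group `G`: every element of `G`
has a unique representation `ω + t` with `ω ∈ Ω`, `t ∈ T`. -/
def IsTilingPair {G : Type*} [AddCommGroup G] (Ω T : Set G) : Prop :=
  ∀ g : G, ∃! p : G × G, p.1 ∈ Ω ∧ p.2 ∈ T ∧ p.1 + p.2 = g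

/-- A nonempty subset `A` of `G` is periodic if `A + g = A` for some nonzero `g`. -/
def IsPeriodic {G : Type*} [AddCommGroup G] (A : Set G) : Prop :=
  A.Nonempty ∧ ∃ g : G, g ≠ 0 ∧ (fun a => a + g) '' A = A

/-- `Ω` is a tile of `G` if it has a tiling complement. -/
def IsTile {G : Type*} [AddCommGroup G] (Ω : Set G) : Prop :=
  ∃ T : Set G, IsTilingPair Ω T

/-- `G` has the periodic tiling (PT) property: for every tiling pair `(Ω, T)`,
either `Ω` is periodic, or `T` can be replaced by a periodic tiling complement. -/
def HasPT (G : Type*) [AddCommGroup G] : Prop :=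
  ∀ Ω T : Set G, IsTilingPair Ω T →
    IsPeriodic Ω ∨ ∃ T' : Set G, IsPeriodic T' ∧ IsTilingPair Ω T'

/-- A tile `Ω` is uniformly periodic if all its tiling complements share a
common nonzero period. -/
def UniformlyPeriodic {G : Type*} [AddCommGroup G] (Ω : Set G) : Prop :=
  ∃ g : G, g ≠ 0 ∧ ∀ T : Set G, IsTilingPair Ω T → (fun t => t + g) '' T = T

/-- A tile `Ω` is dual uniformly periodic if there is a periodic tile `Ω'`
which is a tiling complement of every tiling complement of `Ω`. -/
def DualUniformlyPeriodic {G : Type*} [AddCommGroup G] (Ω : Set G) : Prop :=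
  ∃ Ω' : Set G, IsPeriodic Ω' ∧ IsTile Ω' ∧
    ∀ T : Set G, IsTilingPair Ω T → IsTilingPair Ω' T

/-- `G` has the uniformly periodic tiling (UPT) property: every tile of `G`
is either uniformly periodic or dual uniformly periodic. -/
def HasUPT (G : Type*) [AddCommGroup G] : Prop :=
  ∀ Ω : Set G, IsTile Ω → UniformlyPeriodic Ω ∨ DualUniformlyPeriodic Ω

theorem aux_ring {A I J R : Type*} [AddCommGroup A] [Fintype A] [Fintype I] [Fintype J]
    (q : ℕ) [Fact q.Prime] [CommRing R] [CharP R q] (s : A → R)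
    (hs : ∀ a b, s a * s b = s (a + b)) (hsq : ∀ a, s a ^ q = s (q • a))
    (f : I → A) (h : J → A) (hb : Function.Bijective (fun x : I × J => f x.1 + h x.2))
    (hqI : ¬ q ∣ Fintype.card I) :
    ∑ x : I × J, s (q • f x.1 + h x.2) = ∑ a, s a := by
  have hq : q.Prime := Fact.out
  let F : R := ∑ i, s (f i)
  let H : R := ∑ j, s (h j)
  let S : R := ∑ a, s a
  have hFH : F * H = S := by
    simp only [F, H, S, Finset.sum_mul_sum, hs]
    rw [← Fintype.sum_prod_type']
    exact Function.Bijective.sum_comp hb s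
  have hsS : ∀ b, s b * S = S := fun b => by
    simp only [S, Finset.mul_sum, hs]
    exact Equiv.sum_comp (Equiv.addLeft b) s
  have hFS : F * S = (Fintype.card I : R) * S := by
    simp [F, Finset.sum_mul, hsS]
  have hFn : ∀ n : ℕ, F ^ n * S = (Fintype.card I : R) ^ n * S := by
    intro n
    induction n with
    | zero => simp
    | succ n ih => rw [pow_succ, mul_assoc, hFS, mul_left_comm, ih]; ring
  have hc : (Fintype.card I : R) ^ (q - 1) = 1 := by
    have h0 : (Fintype.card I : ZMod q) ≠ 0 := by
      rwa [Ne, ZMod.natCast_eq_zero_iff]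
    have := congrArg (ZMod.castHom (dvd_refl q) R) (ZMod.pow_card_sub_one_eq_one h0)
    rwa [map_pow, map_natCast, map_one] at this
  have hFq : F ^ q * H = S := by
    have := hFn (q - 1)
    rw [hc, one_mul, ← hFH, ← mul_assoc, ← pow_succ, Nat.sub_add_cancel hq.one_le, hFH] at this
    exact this
  have hFq2 : F ^ q * H = ∑ x : I × J, s (q • f x.1 + h x.2) := by
    simp only [F, H]
    rw [sum_pow_char]
    simp only [Finset.sum_mul_sum, hs, hsq]
    rw [← Fintype.sum_prod_type']
  exact hFq2.symm.trans hFq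

theorem aux_dil_prime {A I J : Type*} [AddCommGroup A] [Fintype A] [Fintype I] [Fintype J]
    (f : I → A) (h : J → A) (hb : Function.Bijective (fun x : I × J => f x.1 + h x.2))
    (q : ℕ) (hq : q.Prime) (hqI : ¬ q ∣ Fintype.card I) :
    Function.Bijective (fun x : I × J => q • f x.1 + h x.2) := by
  classical
  have : Fact q.Prime := ⟨hq⟩
  rw [Fintype.bijective_iff_surjective_and_card]
  refine ⟨?_, Fintype.card_of_bijective hb⟩
  have : CharP (AddMonoidAlgebra (ZMod q) A) q :=
    charP_of_injective_algebraMap (R := ZMod q)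
    (FaithfulSMul.algebraMap_injective (ZMod q) (AddMonoidAlgebra (ZMod q) A)) q
  have e := aux_ring (R := AddMonoidAlgebra (ZMod q) A) q
    (fun a => AddMonoidAlgebra.single a 1)
    (fun a b => by simp [AddMonoidAlgebra.single_mul_single])
    (fun a => by simp [AddMonoidAlgebra.single_pow]) f h hb hqI
  intro a
  by_contra hne
  push Not at hne
  let φ : AddMonoidAlgebra (ZMod q) A →+ ZMod q :=
    AddMonoidHom.mk' (fun r => r.coeff a) (by intros; simp)
  have hφ : ∀ b, φ (AddMonoidAlgebra.single b 1) = if b = a then 1 else 0 := by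
    intro b
    change (AddMonoidAlgebra.single b (1 : ZMod q)).coeff a = _
    simp [Finsupp.single_apply]
  have e := congrArg φ e
  rw [map_sum, map_sum, Finset.sum_eq_zero (fun x _ => by rw [hφ, if_neg (hne x)])] at e
  simp [hφ] at e

theorem aux_dil {A I J : Type*} [AddCommGroup A] [Fintype A] [Fintype I] [Fintype J]
    (h : J → A) (k : ℕ) : k ≠ 0 → Nat.Coprime k (Fintype.card I) → ∀ (f : I → A),
    Function.Bijective (fun x : I × J => f x.1 + h x.2) →
    Function.Bijective (fun x : I × J => k • f x.1 + h x.2) := by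
  induction k using Nat.recOnMul with
  | zero => intro h0; exact absurd rfl h0
  | one => intro _ _ f hb; simpa using hb
  | prime p hp =>
    intro _ hc f hb
    exact aux_dil_prime f h hb p hp (by rwa [← hp.coprime_iff_not_dvd])
  | mul a b iha ihb =>
    intro h0 hc f hb
    have h1 := ihb (right_ne_zero_of_mul h0) (Nat.Coprime.coprime_mul_left hc) f hb
    have h2 := iha (left_ne_zero_of_mul h0) (Nat.Coprime.coprime_mul_right hc) (fun i => b • f i) h1
    simpa [mul_smul] using h2

theorem aux_tp_iff {A : Type*} [AddCommGroup A] (Ω T : Set A) :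
    IsTilingPair Ω T ↔ Function.Bijective (fun x : Ω × T => (x.1 : A) + x.2) := by
  rw [Function.bijective_iff_existsUnique]
  refine forall_congr' fun g => ?_
  constructor
  · rintro ⟨⟨a, b⟩, ⟨ha, hb, hab⟩, hu⟩
    refine ⟨⟨⟨a, ha⟩, ⟨b, hb⟩⟩, hab, ?_⟩
    rintro ⟨⟨c, hc⟩, ⟨d, hd⟩⟩ hcd
    have := hu (c, d) ⟨hc, hd, hcd⟩
    simp only [Prod.mk.injEq] at this
    simp [this.1, this.2]
  · rintro ⟨⟨⟨a, ha⟩, ⟨b, hb⟩⟩, hab, hu⟩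
    refine ⟨(a, b), ⟨ha, hb, hab⟩, ?_⟩
    rintro ⟨c, d⟩ ⟨hc, hd, hcd⟩
    have := hu ⟨⟨c, hc⟩, ⟨d, hd⟩⟩ hcd
    simpa using this

theorem aux_tp_symm {A : Type*} [AddCommGroup A] {Ω T : Set A} (h : IsTilingPair Ω T) :
    IsTilingPair T Ω := by
  rw [aux_tp_iff] at h ⊢
  have := h.comp (Equiv.prodComm T Ω).bijective
  convert this using 2
  simp [add_comm]

/-- Tiling by fibres. -/
theorem aux_fibre {G B : Type*} [AddCommGroup G] [AddCommGroup B] (Ω : Set (G × B)) (T : Set G) :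
    IsTilingPair Ω {x : G × B | x.1 ∈ T ∧ x.2 = 0} ↔
      ∀ b : B, IsTilingPair {g | (g, b) ∈ Ω} T := by
  constructor
  · intro h b g
    obtain ⟨⟨⟨x, y⟩, ⟨z, w⟩⟩, ⟨h1, ⟨h2, h3⟩, h4⟩, hu⟩ := h (g, b)
    simp only [Prod.mk_add_mk, Prod.mk.injEq] at h2 h3 h4
    subst h3
    obtain ⟨h4, h5⟩ := h4
    rw [add_zero] at h5
    subst h5
    refine ⟨(x, z), ⟨h1, h2, h4⟩, ?_⟩
    rintro ⟨c, d⟩ ⟨hc, hd, hcd⟩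
    have := hu ((c, y), (d, 0)) ⟨hc, ⟨hd, rfl⟩, by simpa using hcd⟩
    simp only [Prod.mk.injEq] at this
    simp [this]
  · rintro h ⟨g, b⟩
    obtain ⟨⟨x, z⟩, ⟨h1, h2, h3⟩, hu⟩ := h b g
    refine ⟨((x, b), (z, 0)), ⟨h1, ⟨h2, rfl⟩, by simpa using h3⟩, ?_⟩
    rintro ⟨⟨c, e⟩, ⟨d, w⟩⟩ ⟨hc, ⟨hd, hw⟩, hcd⟩
    simp only [Prod.mk_add_mk, Prod.mk.injEq] at hw hd hcd
    subst hw
    obtain ⟨h4, h5⟩ := hcd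
    rw [add_zero] at h5
    subst h5
    have := hu (c, d) ⟨hc, hd, h4⟩
    simp only [Prod.mk.injEq] at this
    simp [this]

theorem aux_case1 {A : Type*} [AddCommGroup A] [Fintype A] (Ω T : Set A)
    [Fintype Ω] [Fintype T]
    (h : IsTilingPair Ω T) (k : ℕ) (hk0 : k ≠ 0) (hk : Nat.Coprime k (Fintype.card Ω))
    (z : A) (hz : z ≠ 0) (hkz : k • z = 0) :
    ∃ T' : Set A, IsPeriodic T' ∧ IsTilingPair Ω T' := by
  have hb := aux_dil (I := Ω) (J := T) (fun t => (t : A)) k hk0 hk (fun x => (x : A))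
    ((aux_tp_iff Ω T).1 h)
  have ht : IsTilingPair Ω {t | k • t ∈ T} := by
    intro a
    obtain ⟨⟨⟨w, hw⟩, ⟨t, ht⟩⟩, hwt⟩ := hb.2 (k • a)
    simp only at hwt
    refine ⟨(w, a - w), ⟨hw, ?_, by simp⟩, ?_⟩
    · have : k • (a - w) = t := by rw [smul_sub, ← hwt]; simp
      simpa [this] using ht
    · rintro ⟨w', t'⟩ ⟨hw', ht', hwt'⟩
      have := @hb.1 ⟨⟨w', hw'⟩, ⟨k • t', ht'⟩⟩ ⟨⟨w, hw⟩, ⟨t, ht⟩⟩ (by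
        simp only at hwt' ⊢
        rw [hwt, ← hwt', smul_add])
      simp only [Prod.mk.injEq, Subtype.mk.injEq] at this
      simp only [Prod.mk.injEq]
      refine ⟨this.1, ?_⟩
      rw [← this.1, ← hwt']; simp
  refine ⟨_, ⟨?_, z, hz, ?_⟩, ht⟩
  · obtain ⟨p, hp, -⟩ := ht 0
    exact ⟨p.2, hp.2.1⟩
  · ext x
    simp only [Set.mem_image, Set.mem_ofPred_eq]
    constructor
    · rintro ⟨y, hy, rfl⟩
      simpa [hkz] using hy
    · intro hx
      exact ⟨x - z, by simpa [smul_sub, hkz] using hx, by simp⟩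

/-- If `G` has the UPT property and `m` is squarefree with `gcd(|G|, m) = 1`,
then `G × Z_m` has the PT property. -/
theorem hasPT_prod_of_hasUPT (G : Type*) [AddCommGroup G] [Fintype G]
    (m : ℕ) (hm : 0 < m) (hsq : Squarefree m)
    (hgcd : Nat.gcd (Fintype.card G) m = 1) (hUPT : HasUPT G) :
    HasPT (G × ZMod m) := by
  classical
  have : NeZero m := ⟨hm.ne'⟩
  intro Ω T h
  let _ : Fintype Ω := Fintype.ofFinite _
  let _ : Fintype T := Fintype.ofFinite _
  have hcard : Fintype.card Ω * Fintype.card T = Fintype.card G * m := by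
    have := Fintype.card_of_bijective ((aux_tp_iff Ω T).1 h)
    simpa [ZMod.card] using this
  by_cases hc : Nat.Coprime (Fintype.card T) m
  · have hb := aux_dil (I := T) (J := Ω) (fun t => (t : G × ZMod m)) m hm.ne' hc.symm
      (fun x => (x : G × ZMod m)) ((aux_tp_iff T Ω).1 (aux_tp_symm h))
    have hm2 : ∀ x : G × ZMod m, (m • x).2 = 0 := by simp
    let T' : Set G := {g | ∃ t ∈ T, (m • t).1 = g}
    have hT' : IsTilingPair Ω {x : G × ZMod m | x.1 ∈ T' ∧ x.2 = 0} := by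
      intro a
      obtain ⟨⟨⟨t, ht⟩, ⟨w, hw⟩⟩, hwt⟩ := hb.2 a
      simp only at hwt
      refine ⟨(w, m • t), ⟨hw, ⟨⟨t, ht, rfl⟩, hm2 t⟩, by rw [← hwt, add_comm]⟩, ?_⟩
      rintro ⟨w', y⟩ ⟨hw', ⟨⟨t', ht', hty⟩, hy⟩, hwt'⟩
      have hy' : y = m • t' := Prod.ext hty.symm (by rw [hm2]; exact hy)
      have := @hb.1 ⟨⟨t', ht'⟩, ⟨w', hw'⟩⟩ ⟨⟨t, ht⟩, ⟨w, hw⟩⟩ (by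
        simp only at hwt' ⊢
        rw [hwt, ← hwt', hy', add_comm])
      simp only [Prod.mk.injEq, Subtype.mk.injEq] at this
      simp only [Prod.mk.injEq]
      exact ⟨this.2, by rw [hy', this.1]⟩
    have hfib := (aux_fibre Ω T').1 hT'
    rcases hUPT T' ⟨_, aux_tp_symm (hfib 0)⟩ with ⟨g, hg, hper⟩ | ⟨T'', ⟨⟨t0, ht0⟩, g, hg, hper⟩, -, hall⟩
    · left
      refine ⟨?_, (g, 0), by simpa using hg, ?_⟩
      · obtain ⟨p, hp, -⟩ := h 0
        exact ⟨p.1, hp.1⟩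
      · have key : ∀ b x, (∃ y, (y, b) ∈ Ω ∧ y + g = x) ↔ (x, b) ∈ Ω := fun b x =>
          Set.ext_iff.1 (hper _ (aux_tp_symm (hfib b))) x
        ext ⟨x, b⟩
        rw [← key b x]
        constructor
        · rintro ⟨⟨y, c⟩, hy, hyx⟩
          simp only [Prod.mk_add_mk, add_zero, Prod.mk.injEq] at hyx
          obtain ⟨h1, rfl⟩ := hyx
          exact ⟨y, hy, h1⟩
        · rintro ⟨y, hy, rfl⟩
          exact ⟨(y, b), hy, by simp⟩
    · right
      refine ⟨{x : G × ZMod m | x.1 ∈ T'' ∧ x.2 = 0},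
        ⟨⟨(t0, 0), ht0, rfl⟩, (g, 0), by simpa using hg, ?_⟩,
        (aux_fibre Ω T'').2 fun b => aux_tp_symm (hall _ (aux_tp_symm (hfib b)))⟩
      have key : ∀ x, (∃ y, y ∈ T'' ∧ y + g = x) ↔ x ∈ T'' := fun x => Set.ext_iff.1 hper x
      ext ⟨x, b⟩
      constructor
      · rintro ⟨⟨y, c⟩, ⟨hy, hc⟩, hyx⟩
        simp only [Prod.mk_add_mk, add_zero, Prod.mk.injEq] at hyx hc
        obtain ⟨h1, rfl⟩ := hyx
        exact ⟨(key x).1 ⟨y, hy, h1⟩, hc⟩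
      · rintro ⟨hx, hb0⟩
        obtain ⟨y, hy, hyx⟩ := (key x).2 hx
        exact ⟨(y, b), ⟨hy, hb0⟩, by simpa using hyx⟩
  · obtain ⟨p, hp, hpT, hpm⟩ := Nat.Prime.not_coprime_iff_dvd.1 hc
    right
    obtain ⟨n, rfl⟩ := hpm
    have hpn : Nat.Coprime p n := Nat.coprime_of_squarefree_mul hsq
    have hpG : Nat.Coprime p (Fintype.card G) :=
      (Nat.Coprime.coprime_mul_right_right hgcd).symm
    obtain ⟨t, ht⟩ := hpT
    have hcard2 : Fintype.card Ω * t = Fintype.card G * n := by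
      apply Nat.eq_of_mul_eq_mul_left hp.pos
      rw [ht] at hcard
      linarith [hcard, mul_left_comm p (Fintype.card Ω) t, mul_left_comm p (Fintype.card G) n]
    have hn : 0 < n := Nat.pos_of_mul_pos_left hm
    have hcop : Nat.Coprime p (Fintype.card Ω) :=
      (hpG.mul_right hpn).coprime_dvd_right (Dvd.intro _ hcard2)
    refine aux_case1 Ω T h p hp.ne_zero hcop (0, (n : ZMod (p * n))) ?_ ?_
    · intro h0
      have h1 : (n : ZMod (p * n)) = 0 := (Prod.ext_iff.1 h0).2
      rw [ZMod.natCast_eq_zero_iff] at h1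
      have := Nat.le_of_dvd hn h1
      nlinarith [hp.two_le]
    · refine Prod.ext (by simp) ?_
      have : ((p * n : ℕ) : ZMod (p * n)) = 0 := ZMod.natCast_self _
      rw [Nat.cast_mul] at this
      simpa only [Prod.smul_snd, nsmul_eq_mul, Prod.snd_zero] using this
end

section
/- Let p and q be two distinct primes with q odd. Any finite abelian group which contains a subgroup isomorphic to one of the groups (Z_{p^2})^2 × Z_q, Z_{q^3} × Z_{q^2}, or (Z_{q^2})^3 does not have the periodic tiling (PT) property. -/
lemma tiling_iff {G : Type*} [AddCommGroup G] (Ω T : Set G) :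
    IsTilingPair Ω T ↔ (∀ g, ∃ w ∈ Ω, ∃ t ∈ T, w + t = g) ∧
      (∀ w ∈ Ω, ∀ t ∈ T, ∀ w' ∈ Ω, ∀ t' ∈ T, w + t = w' + t' → w = w' ∧ t = t') := by
  constructor
  · intro h
    refine ⟨fun g => ?_, ?_⟩
    · obtain ⟨⟨w, t⟩, ⟨hw, ht, e⟩, -⟩ := h g
      exact ⟨w, hw, t, ht, e⟩
    · intro w hw t ht w' hw' t' ht' e
      have := (h (w' + t')).unique (y₁ := (w, t)) (y₂ := (w', t')) ⟨hw, ht, e⟩ ⟨hw', ht', rfl⟩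
      simpa using this
  · rintro ⟨h1, h2⟩ g
    obtain ⟨w, hw, t, ht, e⟩ := h1 g
    refine ⟨(w, t), ⟨hw, ht, e⟩, ?_⟩
    rintro ⟨w', t'⟩ ⟨hw', ht', e'⟩
    obtain ⟨a, b⟩ := h2 w' hw' t' ht' w hw t ht (e'.trans e.symm)
    simp [a, b]

/-- Moving a piece `B` of a tile by `u`, when `B + u + T = B + T`. -/
lemma tiling_swap {G : Type*} [AddCommGroup G] {Ω T B : Set G} (u : G)
    (h : IsTilingPair Ω T) (hBΩ : B ⊆ Ω)
    (hB : ∀ b ∈ B, ∀ t ∈ T, ∃ b' ∈ B, ∃ t' ∈ T, b + t = b' + u + t')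
    (hB' : ∀ b ∈ B, ∀ t ∈ T, ∃ b' ∈ B, ∃ t' ∈ T, b + u + t = b' + t') :
    IsTilingPair ((Ω \ B) ∪ {x | x - u ∈ B}) T := by
  rw [tiling_iff] at h ⊢
  obtain ⟨h1, h2⟩ := h
  have mixed : ∀ w ∈ Ω \ B, ∀ t ∈ T, ∀ w', w' - u ∈ B → ∀ t' ∈ T, w + t = w' + t' → False := by
    intro w hw t ht w' hw' t' ht' e
    obtain ⟨b, hb, t2, ht2, e2⟩ := hB' _ hw' t' ht'
    have := h2 w hw.1 t ht b (hBΩ hb) t2 ht2 (by rw [e, ← e2]; abel)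
    exact hw.2 (this.1 ▸ hb)
  refine ⟨fun g => ?_, ?_⟩
  · obtain ⟨w, hw, t, ht, e⟩ := h1 g
    by_cases hwB : w ∈ B
    · obtain ⟨b, hb, t', ht', e'⟩ := hB w hwB t ht
      exact ⟨b + u, Or.inr (by simpa using hb), t', ht', by rw [← e', e]⟩
    · exact ⟨w, Or.inl ⟨hw, hwB⟩, t, ht, e⟩
  · rintro w (hw | hw) t ht w' (hw' | hw') t' ht' e
    · exact h2 w hw.1 t ht w' hw'.1 t' ht' e
    · exact (mixed w hw t ht w' hw' t' ht' e).elim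
    · exact (mixed w' hw' t' ht' w hw t ht e.symm).elim
    · have := h2 _ (hBΩ hw) t ht _ (hBΩ hw') t' ht'
        (by rw [sub_add_eq_add_sub, sub_add_eq_add_sub, e])
      exact ⟨sub_left_injective this.1, this.2⟩

lemma periodic_prime {G : Type*} [AddCommGroup G] [Finite G] {A : Set G} (h : IsPeriodic A) :
    ∃ g : G, g ≠ 0 ∧ (∃ r : ℕ, r.Prime ∧ r • g = 0) ∧ ∀ a ∈ A, a + g ∈ A := by
  obtain ⟨-, g, hg, hA⟩ := h
  have h1 : ∀ a ∈ A, a + g ∈ A := fun a ha => hA ▸ ⟨a, ha, rfl⟩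
  have hk : ∀ k : ℕ, ∀ a ∈ A, a + k • g ∈ A := by
    intro k
    induction k with
    | zero => simp
    | succ k ih =>
      intro a ha
      rw [succ_nsmul, ← add_assoc]
      exact h1 _ (ih a ha)
  have hn : addOrderOf g ≠ 1 := by simpa using hg
  obtain ⟨r, hr, hrd⟩ := Nat.exists_prime_and_dvd hn
  obtain ⟨k, hk'⟩ := hrd
  have hpos := addOrderOf_pos g
  refine ⟨k • g, ?_, ⟨r, hr, ?_⟩, hk k⟩
  · intro h0
    have hd := addOrderOf_dvd_of_nsmul_eq_zero h0
    have hkpos : 0 < k := by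
      rcases Nat.eq_zero_or_pos k with h | h
      · rw [h, mul_zero] at hk'; omega
      · exact h
    have := Nat.le_of_dvd hkpos hd
    rw [hk'] at this
    have := hr.two_le
    nlinarith
  · rw [← mul_nsmul', ← hk', addOrderOf_nsmul_eq_zero]

/-- The base tiling. -/
lemma base_tiling {G : Type*} [AddCommGroup G] (S : AddSubgroup G) (m p : ℤ)
    (hm : 0 < m) (hp : 2 ≤ p) (e1 e2 : G)
    (hmem : ∀ x y : ℤ, x • e1 + y • e2 ∈ S ↔ m * p ∣ x ∧ p ∣ y) :
    ∃ R : Set G, IsTilingPair {x : G | ∃ s ∈ S, ∃ j : ℤ, 0 ≤ j ∧ j < m ∧ x = s + j • e1}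
      {t : G | ∃ a b : ℤ, 0 ≤ a ∧ a < p ∧ 0 ≤ b ∧ b < p ∧ ∃ r ∈ R,
        t = (m * a) • e1 + b • e2 + r} := by
  let N : AddSubgroup G := S ⊔ AddSubgroup.zmultiples e1 ⊔ AddSubgroup.zmultiples e2
  have hSN : S ≤ N := le_sup_left.trans le_sup_left
  have h1N : e1 ∈ N :=
    (le_sup_right.trans le_sup_left : AddSubgroup.zmultiples e1 ≤ N)
      (AddSubgroup.mem_zmultiples e1)
  have h2N : e2 ∈ N :=
    (le_sup_right : AddSubgroup.zmultiples e2 ≤ N) (AddSubgroup.mem_zmultiples e2)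
  refine ⟨Set.range (Quotient.out : G ⧸ N → G), ?_⟩
  rw [tiling_iff]
  constructor
  · intro g
    set r : G := Quotient.out (QuotientAddGroup.mk g : G ⧸ N) with hr
    have hgr : -r + g ∈ N := by
      rw [← QuotientAddGroup.eq]
      exact Quotient.out_eq _
    obtain ⟨z, hz, w, hw, e⟩ := AddSubgroup.mem_sup.1 hgr
    obtain ⟨s, hs, v, hv, e'⟩ := AddSubgroup.mem_sup.1 hz
    obtain ⟨x, rfl⟩ := AddSubgroup.mem_zmultiples_iff.1 hv
    obtain ⟨y, rfl⟩ := AddSubgroup.mem_zmultiples_iff.1 hw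
    have hx1 := Int.emod_add_mul_ediv x m
    have hx2 := Int.emod_add_mul_ediv (x / m) p
    have hy := Int.emod_add_mul_ediv y p
    refine ⟨s + ((m * p * (x / m / p)) • e1 + (p * (y / p)) • e2) + (x % m) • e1,
      ⟨_, S.add_mem hs ((hmem _ _).2 ⟨Dvd.intro _ rfl, Dvd.intro _ rfl⟩), _,
        Int.emod_nonneg _ (by omega), Int.emod_lt_of_pos _ hm, rfl⟩,
      (m * (x / m % p)) • e1 + (y % p) • e2 + r,
      ⟨_, _, Int.emod_nonneg _ (by omega), Int.emod_lt_of_pos _ (by omega),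
        Int.emod_nonneg _ (by omega), Int.emod_lt_of_pos _ (by omega), r, ⟨_, rfl⟩, rfl⟩, ?_⟩
    have hg : g = s + x • e1 + y • e2 + r := by
      rw [e', e]; abel
    have hxx : x = x % m + m * (x / m % p + p * (x / m / p)) := by rw [hx2, hx1]
    rw [hg]
    conv_rhs => rw [hxx, ← hy]
    module
  · rintro w ⟨s, hs, j, hj0, hj, rfl⟩ t ⟨a, b, ha0, ha, hb0, hb, r, ⟨c, rfl⟩, rfl⟩
      w' ⟨s', hs', j', hj0', hj', rfl⟩ t' ⟨a', b', ha0', ha', hb0', hb', r', ⟨c', rfl⟩, rfl⟩ e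
    have hc : c = c' := by
      rw [← Quotient.out_eq c, ← Quotient.out_eq c']
      refine QuotientAddGroup.eq.2 ?_
      have : -c.out + c'.out = (s - s') + ((j - j') + m * (a - a')) • e1 + (b - b') • e2 := by
        linear_combination (norm := module) -e
      rw [this]
      exact N.add_mem (N.add_mem (hSN (S.sub_mem hs hs')) (N.zsmul_mem h1N _))
        (N.zsmul_mem h2N _)
    subst hc
    have hd : ((j - j') + m * (a - a')) • e1 + (b - b') • e2 ∈ S := by
      have : ((j - j') + m * (a - a')) • e1 + (b - b') • e2 = s' - s := by
        linear_combination (norm := module) e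
      rw [this]
      exact S.sub_mem hs' hs
    obtain ⟨hd1, hd2⟩ := (hmem _ _).1 hd
    have hbb : b - b' = 0 := Int.eq_zero_of_abs_lt_dvd hd2 (by rw [abs_lt]; omega)
    have hjj : j - j' = 0 := by
      refine Int.eq_zero_of_abs_lt_dvd (m := m) ?_ (by rw [abs_lt]; omega)
      exact (Int.dvd_add_left (Dvd.intro _ rfl)).1 ((Dvd.intro _ rfl).trans hd1)
    rw [hjj, zero_add] at hd1
    have haa : a - a' = 0 := Int.eq_zero_of_abs_lt_dvd
      (Int.dvd_of_mul_dvd_mul_left (by omega) hd1) (by rw [abs_lt]; omega)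
    obtain rfl : b = b' := by omega
    obtain rfl : j = j' := by omega
    obtain rfl : a = a' := by omega
    simpa using e

lemma core {G : Type*} [AddCommGroup G] [Finite G] (S : AddSubgroup G)
    (hS : ∀ g : G, ∀ r : ℕ, r.Prime → r • g = 0 → g ∈ S) (m p : ℤ)
    (hm : 0 < m) (hp : 2 ≤ p) (e1 e2 c : G) (hc : c ∈ S) (j0 : ℤ) (hj0 : 0 ≤ j0) (hj0m : j0 < m)
    (hmem : ∀ x y : ℤ, x • e1 + y • e2 ∈ S ↔ m * p ∣ x ∧ p ∣ y)
    (hK : ∀ x y : ℤ, (m * p * x) • e1 = (p * y) • e2 → (m * p * x) • e1 = 0)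
    (hdisj : ∀ x y : ℤ, (m * p * x) • e1 ≠ c + j0 • e1 + (p * y) • e2)
    (hdiff : ∀ g ∈ S, ∃ s ∈ S, ∃ j : ℤ, 0 ≤ j ∧ j < m ∧
      (∀ x : ℤ, s + j • e1 ≠ (m * p * x) • e1) ∧
      (∀ x : ℤ, s + j • e1 + g ≠ (m * p * x) • e1) ∧
      (∀ y : ℤ, s + j • e1 ≠ c + j0 • e1 + (p * y) • e2) ∧
      (∀ y : ℤ, s + j • e1 + g ≠ c + j0 • e1 + (p * y) • e2)) : ¬ HasPT G := by
  obtain ⟨R, hR⟩ := base_tiling S m p hm hp e1 e2 hmem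
  have hS1 : ∀ x : ℤ, (m * p * x) • e1 ∈ S := fun x => by
    simpa using (hmem (m * p * x) 0).2 ⟨Dvd.intro _ rfl, dvd_zero _⟩
  have hS2 : ∀ x : ℤ, (p * x) • e2 ∈ S := fun x => by
    simpa using (hmem 0 (p * x)).2 ⟨dvd_zero _, Dvd.intro _ rfl⟩
  have hp1 : ∀ z : ℤ, ¬ p ∣ 1 + p * z := by
    intro z hz
    have := Int.le_of_dvd one_pos ((Int.dvd_add_left (Dvd.intro _ rfl)).1 hz)
    omega
  set Ω0 : Set G := {x : G | ∃ s ∈ S, ∃ j : ℤ, 0 ≤ j ∧ j < m ∧ x = s + j • e1} with hΩ0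
  set T : Set G := {t : G | ∃ a b : ℤ, 0 ≤ a ∧ a < p ∧ 0 ≤ b ∧ b < p ∧ ∃ r ∈ R,
        t = (m * a) • e1 + b • e2 + r} with hT
  let B1 : Set G := {x | ∃ z : ℤ, x = (m * p * z) • e1}
  let B2 : Set G := {x | ∃ z : ℤ, x = c + j0 • e1 + (p * z) • e2}
  have h1 : IsTilingPair ((Ω0 \ B1) ∪ {x | x - m • e1 ∈ B1}) T := by
    refine tiling_swap (m • e1) hR ?_ ?_ ?_
    · rintro x ⟨z, rfl⟩
      exact ⟨_, hS1 z, 0, le_rfl, hm, by simp⟩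
    · rintro x ⟨z, rfl⟩ t ⟨a, b, ha0, ha, hb0, hb, r, hr, rfl⟩
      by_cases h : a = 0
      · subst h
        exact ⟨_, ⟨z - 1, rfl⟩, _, ⟨p - 1, b, by omega, by omega, hb0, hb, r, hr, rfl⟩, by module⟩
      · exact ⟨_, ⟨z, rfl⟩, _, ⟨a - 1, b, by omega, by omega, hb0, hb, r, hr, rfl⟩, by module⟩
    · rintro x ⟨z, rfl⟩ t ⟨a, b, ha0, ha, hb0, hb, r, hr, rfl⟩
      by_cases h : a = p - 1
      · subst h
        exact ⟨_, ⟨z + 1, rfl⟩, _, ⟨0, b, by omega, by omega, hb0, hb, r, hr, rfl⟩, by module⟩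
      · exact ⟨_, ⟨z, rfl⟩, _, ⟨a + 1, b, by omega, by omega, hb0, hb, r, hr, rfl⟩, by module⟩
  have h2 : IsTilingPair ((((Ω0 \ B1) ∪ {x | x - m • e1 ∈ B1}) \ B2) ∪ {x | x - e2 ∈ B2}) T := by
    refine tiling_swap e2 h1 ?_ ?_ ?_
    · rintro x ⟨z, rfl⟩
      refine Or.inl ⟨⟨c + (p * z) • e2, S.add_mem hc (hS2 z), j0, hj0, hj0m, by abel⟩, ?_⟩
      rintro ⟨x, hx⟩
      exact hdisj _ _ hx.symm
    · rintro x ⟨z, rfl⟩ t ⟨a, b, ha0, ha, hb0, hb, r, hr, rfl⟩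
      by_cases h : b = 0
      · subst h
        exact ⟨_, ⟨z - 1, rfl⟩, _, ⟨a, p - 1, ha0, ha, by omega, by omega, r, hr, rfl⟩, by module⟩
      · exact ⟨_, ⟨z, rfl⟩, _, ⟨a, b - 1, ha0, ha, by omega, by omega, r, hr, rfl⟩, by module⟩
    · rintro x ⟨z, rfl⟩ t ⟨a, b, ha0, ha, hb0, hb, r, hr, rfl⟩
      by_cases h : b = p - 1
      · subst h
        exact ⟨_, ⟨z + 1, rfl⟩, _, ⟨a, 0, ha0, ha, by omega, by omega, r, hr, rfl⟩, by module⟩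
      · exact ⟨_, ⟨z, rfl⟩, _, ⟨a, b + 1, ha0, ha, by omega, by omega, r, hr, rfl⟩, by module⟩
  intro hPT
  rcases hPT _ _ h2 with hper | ⟨T', hper, hT'⟩
  · obtain ⟨g, hg, ⟨r, hr, hrg⟩, hadd⟩ := periodic_prime hper
    have hgS := hS g r hr hrg
    have k1 : ∃ z : ℤ, g = (m * p * z) • e1 := by
      have hin := hadd (m • e1) (Or.inl ⟨Or.inr ⟨0, by simp⟩, by
        rintro ⟨z, hz⟩
        have : (m - j0) • e1 + (0 : ℤ) • e2 ∈ S := by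
          have : (m - j0) • e1 + (0 : ℤ) • e2 = c + (p * z) • e2 := by
            linear_combination (norm := module) hz
          rw [this]
          exact S.add_mem hc (hS2 z)
        have := Int.le_of_dvd (by omega) ((hmem _ _).1 this).1
        nlinarith⟩)
      rcases hin with ⟨⟨⟨s, hs, j, hj, hjm, e⟩, -⟩ | ⟨z, hz⟩, -⟩ | ⟨z, hz⟩
      · have : (m - j) • e1 + (0 : ℤ) • e2 ∈ S := by
          have : (m - j) • e1 + (0 : ℤ) • e2 = s - g := by
            linear_combination (norm := module) e
          rw [this]
          exact S.sub_mem hs hgS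
        have := Int.le_of_dvd (by omega) ((hmem _ _).1 this).1
        nlinarith
      · exact ⟨z, by rw [← hz]; abel⟩
      · exfalso
        have : (j0 - m) • e1 + (1 + p * z) • e2 ∈ S := by
          have : (j0 - m) • e1 + (1 + p * z) • e2 = g - c := by
            linear_combination (norm := module) -hz
          rw [this]
          exact S.sub_mem hgS hc
        exact hp1 z ((hmem _ _).1 this).2
    have k2 : ∃ z : ℤ, g = (p * z) • e2 := by
      have hin := hadd (c + j0 • e1 + e2) (Or.inr ⟨0, by simp⟩)
      rcases hin with ⟨⟨⟨s, hs, j, hj, hjm, e⟩, -⟩ | ⟨z, hz⟩, -⟩ | ⟨z, hz⟩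
      · exfalso
        have : (j0 - j) • e1 + (1 + p * 0) • e2 ∈ S := by
          have : (j0 - j) • e1 + (1 + p * 0) • e2 = s - g - c := by
            linear_combination (norm := module) e
          rw [this]
          exact S.sub_mem (S.sub_mem hs hgS) hc
        exact hp1 0 ((hmem _ _).1 this).2
      · exfalso
        have : (j0 - m) • e1 + (1 + p * 0) • e2 ∈ S := by
          have : (j0 - m) • e1 + (1 + p * 0) • e2 = (m * p * z) • e1 - g - c := by
            linear_combination (norm := module) hz
          rw [this]
          exact S.sub_mem (S.sub_mem (hS1 z) hgS) hc
        exact hp1 0 ((hmem _ _).1 this).2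
      · refine ⟨z, ?_⟩
        linear_combination (norm := module) hz
    obtain ⟨x, hx⟩ := k1
    obtain ⟨y, hy⟩ := k2
    exact hg (hx.trans (hK x y (hx.symm.trans hy)))
  · obtain ⟨g, hg, ⟨r, hr, hrg⟩, hadd⟩ := periodic_prime hper
    have hgS := hS g r hr hrg
    obtain ⟨t, ht⟩ := hper.1
    obtain ⟨s, hs, j, hj, hjm, d1, d2, d3, d4⟩ := hdiff g hgS
    rw [tiling_iff] at hT'
    have := hT'.2 (s + j • e1)
      (Or.inl ⟨Or.inl ⟨⟨s, hs, j, hj, hjm, rfl⟩, fun ⟨x, hx⟩ => d1 x hx⟩, fun ⟨y, hy⟩ => d3 y hy⟩)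
      (t + g) (hadd t ht) (s + j • e1 + g)
      (Or.inl ⟨Or.inl ⟨⟨s + g, S.add_mem hs hgS, j, hj, hjm, by abel⟩,
        fun ⟨x, hx⟩ => d2 x hx⟩, fun ⟨y, hy⟩ => d4 y hy⟩)
      t ht (by abel)
    exact hg (by simpa using this.2)

lemma exists_socle (G : Type*) [AddCommGroup G] [Finite G] :
    ∃ (S : AddSubgroup G) (N : ℤ), (∀ g, g ∈ S ↔ N • g = 0) ∧
      (∀ g : G, ∀ r : ℕ, r.Prime → r • g = 0 → g ∈ S) ∧
      (∀ g : G, g ≠ 0 → ∀ r : ℕ, r.Prime → (r : ℤ) • g = 0 →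
        ∃ N' : ℤ, N = r * N' ∧ IsCoprime (r : ℤ) N') := by
  have hcard : Nat.card G ≠ 0 := Nat.card_pos.ne'
  set N : ℕ := UniqueFactorizationMonoid.radical (Nat.card G) with hN
  have key : ∀ g : G, g ≠ 0 → ∀ r : ℕ, r.Prime → r • g = 0 → r ∣ N := by
    intro g hg r hr hrg
    have := Fact.mk hr
    have h1 : addOrderOf g = r := addOrderOf_eq_prime hrg hg
    have h2 : r ∣ Nat.card G := h1 ▸ addOrderOf_dvd_natCard g
    exact (UniqueFactorizationMonoid.dvd_radical_iff_of_irreducible hr.prime.irreducible hcard).2 h2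
  refine ⟨(nsmulAddMonoidHom N : G →+ G).ker, N, fun g => by simp [AddMonoidHom.mem_ker], ?_, ?_⟩
  · intro g r hr hrg
    by_cases hg : g = 0
    · rw [hg]; exact zero_mem _
    · obtain ⟨k, hk⟩ := key g hg r hr hrg
      rw [AddMonoidHom.mem_ker, nsmulAddMonoidHom_apply, hk, mul_nsmul, hrg, nsmul_zero]
  · intro g hg r hr hrg
    obtain ⟨k, hk⟩ := key g hg r hr (by exact_mod_cast hrg)
    refine ⟨k, by rw [hk]; push_cast; rfl, ?_⟩
    rw [Nat.isCoprime_iff_coprime, hr.coprime_iff_not_dvd]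
    rintro ⟨l, rfl⟩
    have hsq : Squarefree N := UniqueFactorizationMonoid.squarefree_radical
    have := hsq r ⟨l, by rw [hk]; ring⟩
    exact hr.one_lt.ne' (Nat.isUnit_iff.1 this)

lemma dvd_aux (p N' x : ℤ) (k : ℕ) (hp : p ≠ 0) (hc : IsCoprime p N') :
    p ^ (k + 1) ∣ p * N' * x ↔ p ^ k ∣ x := by
  rw [pow_succ', mul_assoc, mul_dvd_mul_iff_left hp]
  exact ⟨fun h => IsCoprime.dvd_of_dvd_mul_left (IsCoprime.pow_left hc) h,
    fun h => h.mul_left _⟩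

lemma caseA {G : Type*} [AddCommGroup G] [Finite G] (p q : ℕ) (hp : p.Prime) (hq : q.Prime)
    (hpq : 4 < p * q) (e1 e2 b : G)
    (hrel : ∀ x y z : ℤ, x • e1 + y • e2 + z • b = 0 ↔
      (p : ℤ) ^ 2 ∣ x ∧ (p : ℤ) ^ 2 ∣ y ∧ (q : ℤ) ∣ z) : ¬ HasPT G := by
  classical
  obtain ⟨S, N, hSN, hS, hdiv⟩ := exists_socle G
  have hp2 : (2 : ℤ) ≤ p := by exact_mod_cast hp.two_le
  have hq2 : (2 : ℤ) ≤ q := by exact_mod_cast hq.two_le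
  have hp0 : (p : ℤ) ≠ 0 := by omega
  have hpp : ∀ x : ℤ, (p : ℤ) ^ 2 ∣ p * x ↔ (p : ℤ) ∣ x := fun x => by
    rw [pow_two, mul_dvd_mul_iff_left hp0]
  have hb0 : (q : ℤ) • b = 0 := by simpa using (hrel 0 0 q).2 (by simp)
  have hpe1 : ∀ x : ℤ, ((p : ℤ) * x) • e1 = 0 ↔ (p : ℤ) ∣ x := fun x => by
    simpa [hpp] using hrel (p * x) 0 0
  have hnz : (p : ℤ) • e1 ≠ 0 := fun h => by
    have h1 := (hpe1 1).1 (by simpa using h)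
    have := Int.le_of_dvd one_pos h1
    omega
  have hbnz : b ≠ 0 := fun h => by
    have h1 : (q : ℤ) ∣ 1 := by simpa [h] using hrel 0 0 1
    have := Int.le_of_dvd one_pos h1
    omega
  obtain ⟨N', hN', hcop⟩ := hdiv _ hnz p hp (by
    rw [smul_smul]; exact (hpe1 p).2 dvd_rfl)
  obtain ⟨M', hM', -⟩ := hdiv _ hbnz q hq hb0
  have hbS : b ∈ S := by
    rw [hSN, hM', mul_comm, mul_smul, hb0, smul_zero]
  have hd : ∀ x : ℤ, (p : ℤ) ^ 2 ∣ N * x ↔ (p : ℤ) ∣ x := fun x => by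
    rw [hN', dvd_aux _ _ _ 1 hp0 hcop, pow_one]
  have hmem : ∀ x y : ℤ, x • e1 + y • e2 ∈ S ↔ 1 * (p : ℤ) ∣ x ∧ (p : ℤ) ∣ y := by
    intro x y
    have := hrel (N * x) (N * y) 0
    simp only [hd, dvd_zero, and_true, zero_smul, add_zero] at this
    rw [hSN, smul_add, smul_smul, smul_smul, this, one_mul]
  have hK : ∀ x y : ℤ, (1 * (p : ℤ) * x) • e1 = ((p : ℤ) * y) • e2 →
      (1 * (p : ℤ) * x) • e1 = 0 := by
    intro x y h
    rw [one_mul] at h ⊢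
    have := (hrel (p * x) (-(p * y)) 0).1 (by rw [h]; module)
    rw [hpe1, ← hpp]
    exact this.1
  have hq1 : ¬ (q : ℤ) ∣ 1 := fun h => by
    have := Int.le_of_dvd one_pos h
    omega
  refine core S hS 1 p one_pos hp2 e1 e2 b hbS 0 le_rfl one_pos hmem hK ?_ ?_
  · intro x y h
    have := (hrel (1 * p * x) (-(p * y)) (-1)).1 (by rw [h]; module)
    exact hq1 (by simpa using this.2.2)
  · intro g hg
    let F : (Fin p × Fin p) × Fin q → G := fun i =>
      ((p : ℤ) * (i.1.1 : ℕ)) • e1 + ((p : ℤ) * (i.1.2 : ℕ)) • e2 + ((i.2 : ℕ) : ℤ) • b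
    have hF : Function.Injective F := by
      rintro ⟨⟨i, j⟩, k⟩ ⟨⟨i', j'⟩, k'⟩ h
      have h0 := (hrel (p * ((i : ℕ) - (i' : ℕ))) (p * ((j : ℕ) - (j' : ℕ)))
        ((k : ℕ) - (k' : ℕ))).1 (by
          simp only [F] at h
          linear_combination (norm := module) h)
      rw [hpp, hpp] at h0
      have a1 := Int.eq_zero_of_abs_lt_dvd h0.1 (by rw [abs_lt]; omega)
      have a2 := Int.eq_zero_of_abs_lt_dvd h0.2.1 (by rw [abs_lt]; omega)
      have a3 := Int.eq_zero_of_abs_lt_dvd h0.2.2 (by rw [abs_lt]; omega)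
      simp only [Prod.mk.injEq, Fin.ext_iff]
      omega
    have hFS : ∀ i, F i ∈ S := fun i => S.add_mem
      ((hmem _ _).2 ⟨by rw [one_mul]; exact Dvd.intro _ rfl, Dvd.intro _ rfl⟩) (S.zsmul_mem hbS _)
    let C1 : Finset G := (Finset.range p).image fun i : ℕ => ((p : ℤ) * i) • e1
    let C2 : Finset G := (Finset.range p).image fun i : ℕ => b + ((p : ℤ) * i) • e2
    have hred : ∀ x : ℤ, ∃ i ∈ Finset.range p, (p : ℤ) ∣ x - (i : ℕ) := by
      intro x
      have h1 := Int.emod_nonneg x hp0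
      have h2 := Int.emod_lt_of_pos x (show (0 : ℤ) < p by omega)
      refine ⟨(x % p).toNat, by rw [Finset.mem_range]; omega, ?_⟩
      rw [Int.toNat_of_nonneg h1]
      exact Int.dvd_self_sub_emod
    have hC1 : ∀ x : ℤ, (1 * (p : ℤ) * x) • e1 ∈ C1 := by
      intro x
      obtain ⟨i, hi, hxi⟩ := hred x
      refine Finset.mem_image.2 ⟨i, hi, ?_⟩
      have := (hpe1 _).2 hxi
      linear_combination (norm := module) -this
    have hpe2 : ∀ x : ℤ, ((p : ℤ) * x) • e2 = 0 ↔ (p : ℤ) ∣ x := fun x => by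
      simpa [hpp] using hrel 0 (p * x) 0
    have hC2 : ∀ x : ℤ, b + (0 : ℤ) • e1 + ((p : ℤ) * x) • e2 ∈ C2 := by
      intro x
      obtain ⟨i, hi, hxi⟩ := hred x
      refine Finset.mem_image.2 ⟨i, hi, ?_⟩
      have := (hpe2 _).2 hxi
      linear_combination (norm := module) -this
    have c1 : C1.card ≤ p := Finset.card_image_le.trans (by simp)
    have c2 : C2.card ≤ p := Finset.card_image_le.trans (by simp)
    let Bad : Finset G := (C1 ∪ C1.image (· - g)) ∪ (C2 ∪ C2.image (· - g))
    have hBad : Bad.card < (Finset.univ.image F).card := by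
      rw [Finset.card_image_of_injective _ hF]
      have b1 := Finset.card_union_le (C1 ∪ C1.image (· - g)) (C2 ∪ C2.image (· - g))
      have b2 := Finset.card_union_le C1 (C1.image (· - g))
      have b3 := Finset.card_union_le C2 (C2.image (· - g))
      have b4 : (C1.image (· - g)).card ≤ C1.card := Finset.card_image_le
      have b5 : (C2.image (· - g)).card ≤ C2.card := Finset.card_image_le
      have : Bad.card ≤ 4 * p := by
        simp only [Bad]; omega
      refine this.trans_lt ?_
      simp only [Finset.card_univ, Fintype.card_prod, Fintype.card_fin]
      have := hp.pos
      nlinarith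
    obtain ⟨s, hs, hsB⟩ := Finset.exists_mem_notMem_of_card_lt_card hBad
    obtain ⟨i, -, rfl⟩ := Finset.mem_image.1 hs
    simp only [Bad, Finset.mem_union, not_or, Finset.mem_image, not_exists, not_and] at hsB
    obtain ⟨⟨n1, n2⟩, n3, n4⟩ := hsB
    refine ⟨F i, hFS i, 0, le_rfl, one_pos, fun x hx => ?_, fun x hx => ?_, fun x hx => ?_,
      fun x hx => ?_⟩
    · exact n1 (by rw [zero_smul, add_zero] at hx; rw [hx]; exact hC1 x)
    · exact n2 _ (hC1 x) (by rw [← hx]; simp)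
    · exact n3 (by
        have h := hC2 x
        rw [← hx] at h
        simpa using h)
    · exact n4 _ (hC2 x) (by rw [← hx]; simp)

lemma caseB {G : Type*} [AddCommGroup G] [Finite G] (q : ℕ) (hq : q.Prime)
    (hq3 : 3 ≤ q) (e1 e2 : G)
    (hrel : ∀ x y : ℤ, x • e1 + y • e2 = 0 ↔ (q : ℤ) ^ 3 ∣ x ∧ (q : ℤ) ^ 2 ∣ y) :
    ¬ HasPT G := by
  obtain ⟨S, N, hSN, hS, hdiv⟩ := exists_socle G
  have hq2 : (3 : ℤ) ≤ q := by exact_mod_cast hq3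
  have hq0 : (q : ℤ) ≠ 0 := by omega
  have hpp : ∀ x : ℤ, (q : ℤ) ^ 2 ∣ q * x ↔ (q : ℤ) ∣ x := fun x => by
    rw [pow_two, mul_dvd_mul_iff_left hq0]
  have hpe2 : ∀ x : ℤ, ((q : ℤ) * x) • e2 = 0 ↔ (q : ℤ) ∣ x := fun x => by
    simpa [hpp] using hrel 0 (q * x)
  have hq1 : ∀ a : ℤ, 0 < a → a < q → ¬ (q : ℤ) ∣ a := fun a h0 h1 h => by
    have := Int.le_of_dvd h0 h
    omega
  have hnz : (q : ℤ) • e2 ≠ 0 := fun h =>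
    hq1 1 (by omega) (by omega) ((hpe2 1).1 (by simpa using h))
  obtain ⟨N', hN', hcop⟩ := hdiv _ hnz q hq (by
    rw [smul_smul]; exact (hpe2 q).2 dvd_rfl)
  have hd : ∀ x : ℤ, (q : ℤ) ^ 2 ∣ N * x ↔ (q : ℤ) ∣ x := fun x => by
    rw [hN', dvd_aux _ _ _ 1 hq0 hcop, pow_one]
  have hd3 : ∀ x : ℤ, (q : ℤ) ^ 3 ∣ N * x ↔ (q : ℤ) * q ∣ x := fun x => by
    rw [hN', dvd_aux _ _ _ 2 hq0 hcop, pow_two]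
  have hmem : ∀ x y : ℤ, x • e1 + y • e2 ∈ S ↔ (q : ℤ) * q ∣ x ∧ (q : ℤ) ∣ y := by
    intro x y
    have := hrel (N * x) (N * y)
    rw [hd, hd3] at this
    rw [hSN, smul_add, smul_smul, smul_smul, this]
  have hnS : ∀ a : ℤ, 0 < a → a < q → a • e1 ∉ S := fun a h0 h1 h => by
    have h2 := ((hmem a 0).1 (by simpa using h)).1
    exact hq1 a h0 h1 ((Dvd.intro _ rfl).trans h2)
  have hS1 : ∀ x : ℤ, ((q : ℤ) * q * x) • e1 ∈ S := fun x => by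
    simpa using (hmem ((q : ℤ) * q * x) 0).2 ⟨Dvd.intro _ rfl, dvd_zero _⟩
  have hS2 : ∀ x : ℤ, ((q : ℤ) * x) • e2 ∈ S := fun x => by
    simpa using (hmem 0 ((q : ℤ) * x)).2 ⟨dvd_zero _, Dvd.intro _ rfl⟩
  refine core S hS q q (by omega) (by omega) e1 e2 0 S.zero_mem 1 (by omega) (by omega) hmem
    ?_ ?_ ?_
  · intro x y h
    have h1 := (hrel ((q : ℤ) * q * x) (-(q * y))).1 (by rw [h]; module)
    simpa using (hrel ((q : ℤ) * q * x) 0).2 ⟨h1.1, dvd_zero _⟩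
  · intro x y h
    refine hnS 1 (by omega) (by omega) ?_
    have : (1 : ℤ) • e1 = ((q : ℤ) * q * x) • e1 - ((q : ℤ) * y) • e2 := by rw [h]; module
    rw [this]
    exact S.sub_mem (hS1 x) (hS2 y)
  · intro g hg
    refine ⟨0, S.zero_mem, 2, by omega, by omega, fun x hx => ?_, fun x hx => ?_, fun x hx => ?_,
      fun x hx => ?_⟩
    · refine hnS 2 (by omega) (by omega) ?_
      have := hS1 x
      rw [← hx] at this
      simpa using this
    · refine hnS 2 (by omega) (by omega) ?_
      have := S.sub_mem (hS1 x) hg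
      rw [← hx] at this
      simpa using this
    · refine hnS 1 (by omega) (by omega) ?_
      have : (1 : ℤ) • e1 = ((q : ℤ) * x) • e2 := by linear_combination (norm := module) hx
      rw [this]
      exact hS2 x
    · refine hnS 1 (by omega) (by omega) ?_
      have : (1 : ℤ) • e1 = ((q : ℤ) * x) • e2 - g := by linear_combination (norm := module) hx
      rw [this]
      exact S.sub_mem (hS2 x) hg

lemma zsmul_one_dvd (n : ℕ) (x : ℤ) : x • (1 : ZMod n) = 0 ↔ (n : ℤ) ∣ x := by
  rw [zsmul_one, ZMod.intCast_zmod_eq_zero_iff_dvd]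

/-- Any finite abelian group containing a subgroup isomorphic to one of
`(Z_{p²})² × Z_q`, `Z_{q³} × Z_{q²}`, `(Z_{q²})³` (with `p ≠ q` primes,
`q` odd) does not have the PT property. -/
theorem not_hasPT_of_contains (p q : ℕ) (hp : p.Prime) (hq : q.Prime)
    (hpq : p ≠ q) (hqodd : Odd q)
    (G : Type*) [AddCommGroup G] [Fintype G]
    (hG : (∃ f : (ZMod (p ^ 2) × ZMod (p ^ 2)) × ZMod q →+ G, Function.Injective f) ∨
          (∃ f : ZMod (q ^ 3) × ZMod (q ^ 2) →+ G, Function.Injective f) ∨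
          (∃ f : (Fin 3 → ZMod (q ^ 2)) →+ G, Function.Injective f)) :
    ¬ HasPT G := by
  have hq3 : 3 ≤ q := by
    have := hq.two_le
    rcases hqodd with ⟨k, rfl⟩
    omega
  have hp2 := hp.two_le
  rcases hG with ⟨f, hf⟩ | ⟨f, hf⟩ | ⟨f, hf⟩
  · refine caseA p q hp hq (by nlinarith) (f ((1, 0), 0)) (f ((0, 1), 0)) (f ((0, 0), 1)) ?_
    intro x y z
    rw [← map_zsmul, ← map_zsmul, ← map_zsmul, ← map_add, ← map_add, map_eq_zero_iff f hf]
    simp only [Prod.smul_mk, Prod.mk_add_mk, smul_zero, add_zero, zero_add, Prod.mk_eq_zero,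
      zsmul_one_dvd, and_assoc]
    push_cast
    rfl
  · refine caseB q hq hq3 (f (1, 0)) (f (0, 1)) ?_
    intro x y
    rw [← map_zsmul, ← map_zsmul, ← map_add, map_eq_zero_iff f hf]
    simp only [Prod.smul_mk, Prod.mk_add_mk, smul_zero, add_zero, zero_add, Prod.mk_eq_zero,
      zsmul_one_dvd]
    push_cast
    rfl
  · refine caseA q q hq hq (by nlinarith) (f ![1, 0, 0]) (f ![0, 1, 0])
      (f ![0, 0, (q : ℤ) • 1]) ?_
    intro x y z
    rw [← map_zsmul, ← map_zsmul, ← map_zsmul, ← map_add, ← map_add, map_eq_zero_iff f hf,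
      funext_iff, Fin.forall_fin_succ, Fin.forall_fin_succ, Fin.forall_fin_succ]
    have hq0 : (q : ℤ) ≠ 0 := by omega
    have h3 : z • (q : ℤ) • (1 : ZMod (q ^ 2)) = 0 ↔ (q : ℤ) ∣ z := by
      rw [smul_smul, zsmul_one_dvd, mul_comm]
      push_cast
      rw [pow_two, mul_dvd_mul_iff_left hq0]
    have h1 : ∀ x : ℤ, x • (1 : ZMod (q ^ 2)) = 0 ↔ (q : ℤ) ^ 2 ∣ x := fun x => by
      rw [zsmul_one_dvd]
      push_cast
      rfl
    rw [← h3, ← h1 x, ← h1 y]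
    simp [-zsmul_eq_mul]
end

section
/- Let n ≥ 1 and suppose that both (Z_2)^n and (Z_2)^{n-1} have the periodic tiling (PT) property. Then for every tile Ω of (Z_2)^n there exists a subgroup T of (Z_2)^n such that (Ω, T) is a tiling pair; in other words, every tile is a complete set of representatives of the cosets of some subgroup. -/
theorem tp_iff {G : Type*} [AddCommGroup G] (A B : Set G) :
    IsTilingPair A B ↔ (∀ g, ∃ a ∈ A, ∃ b ∈ B, a + b = g) ∧
      (∀ a ∈ A, ∀ b ∈ B, ∀ a' ∈ A, ∀ b' ∈ B, a + b = a' + b' → a = a' ∧ b = b') := by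
  constructor
  · intro h
    refine ⟨fun g => ?_, ?_⟩
    · obtain ⟨p, ⟨h1, h2, h3⟩, -⟩ := h g
      exact ⟨_, h1, _, h2, h3⟩
    · intro a ha b hb a' ha' b' hb' e
      have := (h (a + b)).unique (y₁ := (a, b)) (y₂ := (a', b')) ⟨ha, hb, rfl⟩ ⟨ha', hb', e.symm⟩
      simpa using this
  · rintro ⟨h1, h2⟩ g
    obtain ⟨a, ha, b, hb, e⟩ := h1 g
    refine ⟨(a, b), ⟨ha, hb, e⟩, ?_⟩
    rintro ⟨a', b'⟩ ⟨ha', hb', e'⟩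
    obtain ⟨r, s⟩ := h2 a' ha' b' hb' a ha b hb (e'.trans e.symm)
    simp [r, s]

theorem tp_iff' {G : Type*} [AddCommGroup G] (A B : Set G) :
    IsTilingPair A B ↔ ∀ g, ∃! t, t ∈ B ∧ g - t ∈ A := by
  constructor
  · intro h g
    obtain ⟨⟨a, b⟩, ⟨ha, hb, e⟩, u⟩ := h g
    simp only at ha hb e
    refine ⟨b, ⟨hb, ?_⟩, ?_⟩
    · rw [← e]; simpa using ha
    · rintro t ⟨ht, ht'⟩
      have := u (g - t, t) ⟨ht', ht, by simp⟩
      exact congrArg Prod.snd this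
  · intro h g
    obtain ⟨b, ⟨hb, ha⟩, u⟩ := h g
    refine ⟨(g - b, b), ⟨ha, hb, by simp⟩, ?_⟩
    rintro ⟨a', b'⟩ ⟨ha', hb', e⟩
    simp only at ha' hb' e
    have hb2 := u b' ⟨hb', by rw [← e]; simpa using ha'⟩
    subst hb2
    simp [← e]

theorem tp_symm {G : Type*} [AddCommGroup G] {A B : Set G} (h : IsTilingPair A B) :
    IsTilingPair B A := by
  rw [tp_iff] at h ⊢
  obtain ⟨h1, h2⟩ := h
  refine ⟨fun g => ?_, ?_⟩
  · obtain ⟨a, ha, b, hb, e⟩ := h1 g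
    exact ⟨b, hb, a, ha, by rw [add_comm, e]⟩
  · intro b hb a ha b' hb' a' ha' e
    exact (h2 a ha b hb a' ha' b' hb' (by rw [add_comm, e, add_comm])).symm

theorem tp_map {G H : Type*} [AddCommGroup G] [AddCommGroup H] (e : G ≃+ H) {A B : Set G}
    (h : IsTilingPair A B) : IsTilingPair (e '' A) (e '' B) := by
  rw [tp_iff] at h ⊢
  obtain ⟨h1, h2⟩ := h
  refine ⟨fun g => ?_, ?_⟩
  · obtain ⟨a, ha, b, hb, e'⟩ := h1 (e.symm g)
    exact ⟨e a, ⟨a, ha, rfl⟩, e b, ⟨b, hb, rfl⟩, by rw [← map_add, e']; simp⟩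
  · rintro _ ⟨a, ha, rfl⟩ _ ⟨b, hb, rfl⟩ _ ⟨a', ha', rfl⟩ _ ⟨b', hb', rfl⟩ q
    rw [← map_add, ← map_add] at q
    obtain ⟨r, s⟩ := h2 a ha b hb a' ha' b' hb' (e.injective q)
    exact ⟨by rw [r], by rw [s]⟩

theorem per_map {G H : Type*} [AddCommGroup G] [AddCommGroup H] (e : G ≃+ H) {A : Set G}
    (h : IsPeriodic A) : IsPeriodic (e '' A) := by
  obtain ⟨h1, g, hg, h2⟩ := h
  refine ⟨h1.image _, e g, by simpa using hg, ?_⟩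
  conv_rhs => rw [← h2]
  rw [Set.image_image, Set.image_image]
  simp

theorem hasPT_map {G H : Type*} [AddCommGroup G] [AddCommGroup H] (e : G ≃+ H)
    (h : HasPT G) : HasPT H := by
  intro Ω T hT
  have k : ∀ S : Set H, e '' (e.symm '' S) = S := fun S => by
    rw [Set.image_image]; simp
  rcases h _ _ (tp_map e.symm hT) with h | ⟨T', h1, h2⟩
  · left
    have := per_map e h
    rwa [k] at this
  · right
    refine ⟨e '' T', per_map e h1, ?_⟩
    have := tp_map e h2
    rwa [k] at this

/-- The tile of `G × (Z_2)^2` which is `A` over `0` and `A + x` over the other points. -/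
def bigTile {G : Type*} [AddCommGroup G] (A : Set G) (x : G) : Set (G × (ZMod 2 × ZMod 2)) :=
  {p | (p.2 = 0 ∧ p.1 ∈ A) ∨ (p.2 ≠ 0 ∧ p.1 - x ∈ A)}

theorem bigTile_tp {G : Type*} [AddCommGroup G] {A B : Set G} (x : G) (h : IsTilingPair A B) :
    IsTilingPair (bigTile A x) ((fun b => (b, (0 : ZMod 2 × ZMod 2))) '' B) := by
  rw [tp_iff'] at h ⊢
  rintro ⟨g, u⟩
  by_cases hu : u = 0
  · obtain ⟨t, ⟨h1, h2⟩, h3⟩ := h g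
    refine ⟨(t, 0), ⟨⟨t, h1, rfl⟩, ?_⟩, ?_⟩
    · simp [bigTile, hu, h2]
    · rintro _ ⟨⟨t', h1', rfl⟩, h2'⟩
      simp only [bigTile, Set.mem_ofPred_eq, Prod.mk_sub_mk, hu, sub_zero] at h2'
      simp at h2'
      rw [h3 t' ⟨h1', h2'⟩]
  · obtain ⟨t, ⟨h1, h2⟩, h3⟩ := h (g - x)
    refine ⟨(t, 0), ⟨⟨t, h1, rfl⟩, ?_⟩, ?_⟩
    · simp [bigTile, hu]
      rwa [sub_right_comm]
    · rintro _ ⟨⟨t', h1', rfl⟩, h2'⟩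
      simp only [bigTile, Set.mem_ofPred_eq, Prod.mk_sub_mk, hu, sub_zero] at h2'
      simp at h2'
      rw [h3 t' ⟨h1', by rw [sub_right_comm]; exact h2'.2⟩]

theorem per_iff {G : Type*} [AddCommGroup G] (h2 : ∀ g : G, g + g = 0) (A : Set G) (g : G) :
    (fun a => a + g) '' A = A ↔ ∀ a ∈ A, a + g ∈ A := by
  constructor
  · intro h a ha
    rw [← h]; exact ⟨a, ha, rfl⟩
  · intro h
    ext a
    constructor
    · rintro ⟨b, hb, rfl⟩; exact h b hb
    · intro ha
      exact ⟨a + g, h a ha, by simp [add_assoc, h2]⟩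

theorem bigTile_per {G : Type*} [AddCommGroup G] (h2 : ∀ g : G, g + g = 0) {A : Set G} (x : G)
    (hx : x ≠ 0) (h : IsPeriodic (bigTile A x)) : IsPeriodic A := by
  have hv : ∀ u : ZMod 2 × ZMod 2, u + u = 0 := by decide
  have hv3 : ∀ u : ZMod 2 × ZMod 2, u ≠ 0 → ∃ v, v ≠ 0 ∧ v + u ≠ 0 := by decide
  have hG : ∀ g : G × (ZMod 2 × ZMod 2), g + g = 0 := by
    rintro ⟨g, u⟩; simp [h2, hv]
  obtain ⟨⟨⟨a, w⟩, ha⟩, ⟨g, u⟩, hg, hp⟩ := h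
  rw [per_iff hG] at hp
  have hA : A.Nonempty := by
    rcases ha with ⟨_, h⟩ | ⟨_, h⟩ <;> exact ⟨_, h⟩
  have hneg : ∀ y : G, -y = y := fun y => neg_eq_of_add_eq_zero_left (h2 y)
  refine ⟨hA, ?_⟩
  by_cases hu : u = 0
  · subst hu
    have hg0 : g ≠ 0 := by rintro rfl; exact hg rfl
    refine ⟨g, hg0, (per_iff h2 _ _).2 fun a ha => ?_⟩
    have := hp (a, 0) (Or.inl ⟨rfl, ha⟩)
    simpa [bigTile] using this
  · by_cases hg0 : g = 0
    · subst hg0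
      refine ⟨x, hx, (per_iff h2 _ _).2 fun a ha => ?_⟩
      have := hp (a, 0) (Or.inl ⟨rfl, ha⟩)
      simpa [bigTile, hu, sub_eq_add_neg, hneg] using this
    · refine ⟨g, hg0, (per_iff h2 _ _).2 fun a ha => ?_⟩
      obtain ⟨v, hv1, hv2⟩ := hv3 u hu
      have := hp (a + x, v) (Or.inr ⟨hv1, by simpa using ha⟩)
      simp [bigTile, hv2] at this
      convert this using 1
      abel

open scoped Classical in
/-- indicator of a proposition -/
noncomputable def ind (p : Prop) : ℕ := if p then 1 else 0

theorem ind_true : ind True = 1 := by simp [ind]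

theorem ind_false : ind False = 0 := by simp [ind]

open scoped Classical in
theorem sum_ind_iff {α : Type*} [Fintype α] (P : α → Prop) :
    (∑ t, ind (P t)) = 1 ↔ ∃! t, P t := by
  unfold ind
  rw [Finset.sum_boole, Nat.cast_id, Finset.card_eq_one]
  constructor
  · rintro ⟨a, ha⟩
    have : ∀ t, P t ↔ t = a := fun t => by
      have := congrArg (fun s => t ∈ s) ha
      simpa using this
    exact ⟨a, (this a).2 rfl, fun t ht => (this t).1 ht⟩
  · rintro ⟨a, ha, hu⟩
    refine ⟨a, ?_⟩
    ext t
    simp only [Finset.mem_filter, Finset.mem_univ, true_and, Finset.mem_singleton]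
    exact ⟨hu t, fun h => h ▸ ha⟩

theorem bigTile_proj {G : Type*} [AddCommGroup G] [Finite G] (h2 : ∀ g : G, g + g = 0) {A : Set G}
    (x : G) {T : Set (G × (ZMod 2 × ZMod 2))} (h : IsTilingPair (bigTile A x) T) :
    ∀ g, ∃! t, t ∈ T ∧ g - t.1 ∈ A := by
  have := Fintype.ofFinite G
  rw [tp_iff'] at h
  simp only [← sum_ind_iff] at h ⊢
  have key : ∀ g : G, (∑ t : G × (ZMod 2 × ZMod 2), ind (t ∈ T ∧ g - t.1 ∈ A))
      + 3 * (∑ t : G × (ZMod 2 × ZMod 2), ind (t ∈ T ∧ (g - x) - t.1 ∈ A)) = 4 := by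
    intro g
    have h4 : ∑ i : ZMod 2 × ZMod 2, (∑ t : G × (ZMod 2 × ZMod 2),
        ind (t ∈ T ∧ (g, i) - t ∈ bigTile A x)) = 4 := by
      rw [Finset.sum_congr rfl (fun i _ => h (g, i))]
      simp
    rw [← h4, Finset.sum_comm, Finset.mul_sum, ← Finset.sum_add_distrib]
    refine Finset.sum_congr rfl fun t _ => ?_
    by_cases ht : t ∈ T
    · simp only [ht, true_and]
      rw [← Equiv.sum_comp (Equiv.addRight t.2)]
      have e0 : ∀ i : ZMod 2 × ZMod 2, ((g, Equiv.addRight t.2 i) - t ∈ bigTile A x) ↔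
          ((i = 0 ∧ g - t.1 ∈ A) ∨ (i ≠ 0 ∧ g - x - t.1 ∈ A)) := by
        intro i
        simp only [bigTile, Set.mem_ofPred_eq, Prod.fst_sub, Prod.snd_sub, Equiv.coe_addRight,
          add_sub_cancel_right, sub_right_comm g x]
      simp only [e0]
      have e1 : ∀ F : ZMod 2 × ZMod 2 → ℕ, ∑ i, F i = F (0,0) + F (0,1) + (F (1,0) + F (1,1)) := by
        intro F
        rw [Fintype.sum_prod_type]
        exact (Fin.sum_univ_two _).trans
          (congrArg₂ (· + ·) (Fin.sum_univ_two _) (Fin.sum_univ_two _))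
      have z0 : (((0, 0) : ZMod 2 × ZMod 2) = 0) = True := by simp
      have z1 : (((0, 1) : ZMod 2 × ZMod 2) = 0) = False := by simp
      have z2 : (((1, 0) : ZMod 2 × ZMod 2) = 0) = False := by simp
      have z3 : (((1, 1) : ZMod 2 × ZMod 2) = 0) = False := by simp
      rw [e1]
      simp only [ne_eq, z0, z1, z2, z3, true_and, not_true, not_false_eq_true, false_and, or_false,
        false_or]
      omega
    · simp [ht, ind_false]
  intro g
  have k1 := key g
  have k2 := key (g - x)
  have : g - x - x = g := by rw [sub_sub, h2, sub_zero]
  rw [this] at k2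
  omega

theorem hasPT_down {G : Type*} [AddCommGroup G] [Finite G] [Nontrivial G]
    (h2 : ∀ g : G, g + g = 0) (h : HasPT (G × (ZMod 2 × ZMod 2))) : HasPT G := by
  intro A B hAB
  obtain ⟨x, hx⟩ := exists_ne (0 : G)
  rcases h _ _ (bigTile_tp x hAB) with h | ⟨T, ⟨hTn, ⟨g, u⟩, hg, hp⟩, hT⟩
  · exact Or.inl (bigTile_per h2 x hx h)
  · right
    have hv : ∀ u : ZMod 2 × ZMod 2, u + u = 0 := by decide
    have hG : ∀ g : G × (ZMod 2 × ZMod 2), g + g = 0 := by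
      rintro ⟨g, u⟩; simp [h2, hv]
    rw [per_iff hG] at hp
    have hpr := bigTile_proj h2 x hT
    obtain ⟨t0, ht0⟩ := hTn
    obtain ⟨a, ha⟩ : A.Nonempty := by
      obtain ⟨t, ht, -⟩ := hpr 0
      exact ⟨_, ht.2⟩
    refine ⟨Prod.fst '' T, ⟨⟨_, t0, ht0, rfl⟩, g, ?_, ?_⟩, ?_⟩
    · rintro rfl
      have := (hpr (a + t0.1)).unique (y₁ := t0) (y₂ := t0 + (0, u)) ⟨ht0, by simpa using ha⟩
        ⟨hp _ ht0, by simpa using ha⟩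
      exact hg (by simpa using this)
    · rw [per_iff h2]
      rintro _ ⟨t, ht, rfl⟩
      exact ⟨_, hp t ht, rfl⟩
    · rw [tp_iff']
      intro y
      obtain ⟨t, ⟨h1, h3⟩, hu⟩ := hpr y
      refine ⟨t.1, ⟨⟨t, h1, rfl⟩, h3⟩, ?_⟩
      rintro _ ⟨⟨t', h1', rfl⟩, h3'⟩
      rw [hu t' ⟨h1', h3'⟩]

theorem fin2 {k : ℕ} (g : Fin k → ZMod 2) : g + g = 0 := by
  have : ∀ a : ZMod 2, a + a = 0 := by decide
  ext i; exact this _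

theorem hasPT_down_fin (k : ℕ) (hk : 1 ≤ k) (h : HasPT (Fin (k + 2) → ZMod 2)) :
    HasPT (Fin k → ZMod 2) := by
  have : Nonempty (Fin k) := ⟨⟨0, hk⟩⟩
  have e : (Fin (k + 2) → ZMod 2) ≃ₗ[ZMod 2] ((Fin k → ZMod 2) × (ZMod 2 × ZMod 2)) :=
    LinearEquiv.ofFinrankEq _ _ (by simp)
  exact hasPT_down fin2 (hasPT_map e.toAddEquiv h)

theorem hasPT_all (n : ℕ) (h : HasPT (Fin n → ZMod 2)) (h' : HasPT (Fin (n - 1) → ZMod 2)) :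
    ∀ k, 1 ≤ k → k ≤ n → HasPT (Fin k → ZMod 2) := by
  have key : ∀ d k, 1 ≤ k → k + d = n → HasPT (Fin k → ZMod 2) := by
    intro d
    induction d using Nat.strong_induction_on with
    | _ d ih =>
      intro k hk hd
      match d, ih, hd with
      | 0, _, hd => obtain rfl : k = n := by omega
                    exact h
      | 1, _, hd => obtain rfl : k = n - 1 := by omega
                    exact h'
      | d + 2, ih, hd => exact hasPT_down_fin k hk (ih d (by omega) (k + 2) (by omega) (by omega))
  intro k hk hkn
  exact key (n - k) k hk (by omega)

/-- projection of a tiling along a period of one factor -/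
theorem tp_quot {G Q : Type*} [AddCommGroup G] [AddCommGroup Q] (f : G →+ Q)
    (hf : Function.Surjective f) {A B : Set G} (h : IsTilingPair A B)
    (hB : ∀ b ∈ B, ∀ k, f k = 0 → b + k ∈ B) :
    IsTilingPair (f '' A) (f '' B) ∧ Set.InjOn f A := by
  rw [tp_iff] at h ⊢
  obtain ⟨h1, h2⟩ := h
  refine ⟨⟨fun q => ?_, ?_⟩, ?_⟩
  · obtain ⟨g, rfl⟩ := hf q
    obtain ⟨a, ha, b, hb, e⟩ := h1 g
    exact ⟨f a, ⟨a, ha, rfl⟩, f b, ⟨b, hb, rfl⟩, by rw [← map_add, e]⟩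
  · rintro _ ⟨a, ha, rfl⟩ _ ⟨b, hb, rfl⟩ _ ⟨a', ha', rfl⟩ _ ⟨b', hb', rfl⟩ q
    have hk : f (a + b - (a' + b')) = 0 := by simp [q]
    obtain ⟨r, s⟩ := h2 a ha b hb a' ha' _ (hB b' hb' _ hk) (by abel)
    refine ⟨by rw [r], ?_⟩
    rw [s, map_add, hk, add_zero]
  · intro a ha a' ha' q
    obtain ⟨x, _, b, hb, _⟩ := h1 0
    have hk : f (a - a') = 0 := by simp [q]
    exact (h2 a ha b hb a' ha' _ (hB b hb _ hk) (by abel)).1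

theorem main_ind (n : ℕ) (h : ∀ k, 1 ≤ k → k ≤ n → HasPT (Fin k → ZMod 2)) :
    ∀ (G : Type) [AddCommGroup G] [Module (ZMod 2) G] [Module.Finite (ZMod 2) G],
      Module.finrank (ZMod 2) G = n → ∀ Ω : Set G, IsTile Ω →
      ∃ T : Submodule (ZMod 2) G, IsTilingPair Ω (T : Set G) := by
  induction n with
  | zero =>
    intro G _ _ _ hG Ω ⟨T, hT⟩
    have : Subsingleton G := Module.finrank_zero_iff.1 hG
    obtain ⟨⟨a, b⟩, ⟨ha, hb, -⟩, -⟩ := hT 0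
    refine ⟨⊤, (tp_iff _ _).2 ⟨fun g => ⟨a, ha, 0, by simp, Subsingleton.elim _ _⟩, ?_⟩⟩
    intros
    exact ⟨Subsingleton.elim _ _, Subsingleton.elim _ _⟩
  | succ n ih =>
    intro G _ _ _ hG Ω ⟨T, hT⟩
    have IH := ih fun k hk hkn => h k hk (by omega)
    have e : (Fin (n + 1) → ZMod 2) ≃ₗ[ZMod 2] G := LinearEquiv.ofFinrankEq _ _ (by simp [hG])
    have hPT : HasPT G := hasPT_map e.toAddEquiv (h (n + 1) (by omega) le_rfl)
    have h2 : ∀ g : G, g + g = 0 := fun g => by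
      have : (2 : ZMod 2) • g = 0 := by
        rw [show (2 : ZMod 2) = 0 from rfl, zero_smul]
      rwa [two_smul] at this
    -- the quotient by a period
    have hQ : ∀ g : G, g ≠ 0 → Module.finrank (ZMod 2) (G ⧸ Submodule.span (ZMod 2) {g}) = n := by
      intro g hg
      have := Submodule.finrank_quotient_add_finrank (Submodule.span (ZMod 2) {g})
      rw [finrank_span_singleton hg] at this
      omega
    have hker : ∀ (g : G) (B : Set G), (fun b => b + g) '' B = B →
        ∀ b ∈ B, ∀ k, (Submodule.span (ZMod 2) {g}).mkQ.toAddMonoidHom k = 0 → b + k ∈ B := by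
      intro g B hB b hb k hk
      rw [per_iff h2] at hB
      have hk' : k ∈ Submodule.span (ZMod 2) {g} := by simpa using hk
      obtain ⟨c, rfl⟩ := Submodule.mem_span_singleton.1 hk'
      have hc : c = 0 ∨ c = 1 := by clear hk hk'; revert c; decide
      rcases hc with rfl | rfl
      · simpa using hb
      · simpa using hB b hb
    rcases hPT Ω T hT with ⟨_, g, hg, hp⟩ | ⟨T', ⟨_, g, hg, hp⟩, hT'⟩
    · set f := (Submodule.span (ZMod 2) {g}).mkQ with hf
      have hs : Function.Surjective f := Submodule.mkQ_surjective _
      obtain ⟨t1, -⟩ := tp_quot f.toAddMonoidHom hs (tp_symm hT) (hker g Ω hp)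
      obtain ⟨H, hH⟩ := IH _ (hQ g hg) (f '' Ω) ⟨_, tp_symm t1⟩
      obtain ⟨s, hs'⟩ := f.exists_rightInverse_of_surjective (LinearMap.range_eq_top.2 hs)
      have hsf : ∀ q, f (s q) = q := fun q => by
        simpa using LinearMap.congr_fun hs' q
      refine ⟨H.map s, ?_⟩
      rw [tp_iff] at hH ⊢
      obtain ⟨k1, k2⟩ := hH
      constructor
      · intro y
        obtain ⟨_, ⟨a, ha, rfl⟩, q, hq, e⟩ := k1 (f y)
        refine ⟨a + (y - s q - a), hker g Ω hp a ha _ ?_, s q, ⟨q, hq, rfl⟩, by abel⟩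
        change f _ = 0
        rw [map_sub, map_sub, hsf, ← e]; abel
      · rintro a ha _ ⟨q, hq, rfl⟩ a' ha' _ ⟨q', hq', rfl⟩ e
        have e' := congrArg f e
        rw [map_add, map_add, hsf, hsf] at e'
        obtain ⟨-, rfl⟩ := k2 _ ⟨a, ha, rfl⟩ q hq _ ⟨a', ha', rfl⟩ q' hq' e'
        exact ⟨add_right_cancel e, rfl⟩
    · set f := (Submodule.span (ZMod 2) {g}).mkQ with hf
      have hs : Function.Surjective f := Submodule.mkQ_surjective _
      obtain ⟨t1, hinj⟩ := tp_quot f.toAddMonoidHom hs hT' (hker g T' hp)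
      obtain ⟨H, hH⟩ := IH _ (hQ g hg) (f '' Ω) ⟨_, t1⟩
      refine ⟨H.comap f, ?_⟩
      rw [tp_iff] at hH ⊢
      obtain ⟨k1, k2⟩ := hH
      constructor
      · intro y
        obtain ⟨_, ⟨a, ha, rfl⟩, q, hq, e⟩ := k1 (f y)
        refine ⟨a, ha, y - a, ?_, by abel⟩
        change f (y - a) ∈ H
        rw [map_sub, ← e, add_sub_cancel_left]
        exact hq
      · intro a ha b hb a' ha' b' hb' e
        have e' := congrArg f e
        rw [map_add, map_add] at e'
        obtain ⟨r, -⟩ := k2 _ ⟨a, ha, rfl⟩ (f b) hb _ ⟨a', ha', rfl⟩ (f b') hb' e'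
        obtain rfl := hinj ha ha' r
        exact ⟨rfl, add_left_cancel e⟩

/-- If `(Z_2)^n` and `(Z_2)^{n-1}` have the PT property, then every tile of
`(Z_2)^n` has a subgroup as a tiling complement. -/
theorem tile_compl_subgroup_of_hasPT_two (n : ℕ) (hn : 1 ≤ n)
    (hPT : HasPT (Fin n → ZMod 2)) (hPT' : HasPT (Fin (n - 1) → ZMod 2))
    (Ω : Set (Fin n → ZMod 2)) (hΩ : IsTile Ω) :
    ∃ T : AddSubgroup (Fin n → ZMod 2), IsTilingPair Ω (T : Set (Fin n → ZMod 2)) := by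
  obtain ⟨T, hT⟩ := main_ind n (hasPT_all n hPT hPT') (Fin n → ZMod 2) (by simp) Ω hΩ
  exact ⟨T.toAddSubgroup, hT⟩
end
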